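/- There is an absolute constant c > 0 such that for every integer n ≥ 1 and every d ≥ 0, the least error in uniformly approximating the n-bit AND function by a real polynomial of degree at most d is at most (1/2)·exp(−(c/2)·d²/n). Consequently, for 0 < ε < 1/2, AND_n can be approximated pointwise within ε by a polynomial of degree O(√(n·log(1/ε))). -/

import Mathlib

open Finset Polynomial

theorem sum_range_choose_mul_choose (N a b : ℕ) :
    ∑ m ∈ range (N + 1), m.choose a * (N - m).choose b = (N + 1).choose (a + b + 1) := by
  induction N generalizing b with
  | zero => cases a <;> cases b <;> simp [Nat.choose_eq_zero_of_lt]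
  | succ N ih =>
    cases b with
    | zero =>
      rw [sum_range_succ]
      have := ih 0
      simp only [Nat.choose_zero_right, mul_one, add_zero] at this ⊢
      rw [this, Nat.choose_succ_succ' (N + 1) a, add_comm]
    | succ b =>
      have h : ∀ m ∈ range (N + 1), m.choose a * (N + 1 - m).choose (b + 1) =
          m.choose a * (N - m).choose b + m.choose a * (N - m).choose (b + 1) := by
        intro m hm
        rw [Nat.succ_sub (Nat.lt_succ_iff.mp (mem_range.mp hm)), Nat.choose_succ_succ, mul_add]
      rw [sum_range_succ, sum_congr rfl h, sum_add_distrib, ih, ih]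
      rw [Nat.sub_self, Nat.choose_zero_succ, mul_zero, add_zero, ← add_assoc a b 1,
        Nat.choose_succ_succ' (N + 1)]

theorem sum_range_choose_add_mul_choose {n D d : ℕ} (hD : D = d + 1) (h : D ≤ n) :
    ∑ l ∈ range (D + 1), (l + d).choose d * (n - l).choose (D - l) = (n + D).choose n := by
  have key := sum_range_choose_mul_choose (n + d) d (n - D)
  rw [show n + d + 1 = d + ((D + 1) + (n - D)) by omega, sum_range_add, sum_range_add] at key
  rw [sum_eq_zero (s := range d), sum_eq_zero (s := range (n - D)), zero_add, add_zero] at key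
  · rw [show n + D = d + ((D + 1) + (n - D)) by omega]
    rw [show (d + ((D + 1) + (n - D))).choose n = (d + ((D + 1) + (n - D))).choose (d + (n - D) + 1)
      by rw [show d + (n - D) + 1 = n by omega], ← key]
    refine sum_congr rfl fun l hl => ?_
    have hl := mem_range.mp hl
    rw [add_comm l d, show n + d - (d + l) = n - l by omega]
    rw [← Nat.choose_symm (show D - l ≤ n - l by omega), show n - l - (D - l) = n - D by omega]
  · intro x hx
    have := mem_range.mp hx
    rw [Nat.choose_eq_zero_of_lt (n := n + d - _) (by omega), mul_zero]
  · intro x hx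
    rw [Nat.choose_eq_zero_of_lt (mem_range.mp hx), zero_mul]

theorem sum_range_neg_one_pow_mul_choose_mul_eval {d : ℕ} {P : ℝ[X]} (hP : P.natDegree < d) :
    ∑ k ∈ range (d + 1), (-1 : ℝ) ^ k * d.choose k * P.eval (k : ℝ) = 0 := by
  have h := congrFun (Polynomial.fwdDiff_iter_eq_zero_of_degree_lt hP) 0
  rw [fwdDiff_iter_eq_sum_shift] at h
  have h2 := congrArg (fun t => (-1 : ℝ) ^ d * t) h
  simp only [Pi.zero_apply, mul_zero, mul_sum] at h2
  rw [← h2]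
  refine sum_congr rfl fun k hk => ?_
  have hk := Nat.lt_succ_iff.mp (mem_range.mp hk)
  obtain ⟨j, rfl⟩ := Nat.exists_eq_add_of_le hk
  have : (-1 : ℝ) ^ j * (-1) ^ j = 1 := by rw [← mul_pow]; simp
  simp [pow_add]
  linear_combination (-(-1 : ℝ) ^ k * ((k + j).choose k) * P.eval (k : ℝ)) * this

theorem sum_range_eq_zero_of_choose {M d : ℕ} {w : ℕ → ℝ}
    (hw : ∀ i < d, ∑ y ∈ range (M + 1), w y * ((M - y).choose i : ℝ) = 0)
    {r : ℝ[X]} (hr : r.degree < d) :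
    ∑ y ∈ range (M + 1), w y * r.eval (y : ℝ) = 0 := by
  rcases eq_or_ne r 0 with rfl | hr0
  · simp
  have hd : r.natDegree < d := (natDegree_lt_iff_degree_lt hr0).2 hr
  set s : ℝ[X] := r.comp (C (M : ℝ) - X) with hs
  have hsd : s.natDegree < d := by
    refine lt_of_le_of_lt ?_ hd
    refine natDegree_comp_le.trans ?_
    have : (C (M : ℝ) - X).natDegree ≤ 1 := by compute_degree
    nlinarith
  have hΔ : ∀ i, d ≤ i → (fwdDiff (1 : ℝ))^[i] s.eval 0 = 0 := fun i hi =>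
    congrFun (Polynomial.fwdDiff_iter_eq_zero_of_degree_lt (hsd.trans_le hi)) 0
  have hexp : ∀ y ∈ range (M + 1), r.eval (y : ℝ) =
      ∑ i ∈ range d, ((M - y).choose i : ℝ) * (fwdDiff (1 : ℝ))^[i] s.eval 0 := by
    intro y hy
    have hy := Nat.lt_succ_iff.mp (mem_range.mp hy)
    have h := shift_eq_sum_fwdDiff_iter (1 : ℝ) s.eval (M - y) 0
    have e : s.eval (0 + (M - y) • (1 : ℝ)) = r.eval (y : ℝ) := by
      simp [hs, Nat.cast_sub hy]
    rw [← e, h]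
    simp only [nsmul_eq_mul]
    rcases le_total d (M - y + 1) with hle | hle
    · symm
      apply sum_subset (range_subset_range.2 hle)
      intro i _ hi
      rw [hΔ i (by simpa using hi), mul_zero]
    · apply sum_subset (range_subset_range.2 hle)
      intro i _ hi
      rw [Nat.choose_eq_zero_of_lt (by simp at hi; omega)]; simp
  rw [sum_congr rfl fun y hy => by rw [hexp y hy, mul_sum], sum_comm]
  refine sum_eq_zero fun i hi => ?_
  simp_rw [← mul_assoc, ← sum_mul]
  rw [hw i (mem_range.mp hi), zero_mul]

theorem sum_range_succ_mul_choose_mul_choose (M k i : ℕ) :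
    ∑ y ∈ range (M + 1), (y + 1) * y.choose k * (M - y).choose i =
      (k + 1) * (M + 2).choose (k + i + 2) := by
  have h := sum_range_choose_mul_choose (M + 1) (k + 1) i
  rw [sum_range_succ', Nat.choose_zero_succ, zero_mul, add_zero] at h
  rw [show k + i + 2 = k + 1 + i + 1 by ring, ← h, mul_sum]
  refine sum_congr rfl fun y _ => ?_
  rw [Nat.add_one_mul_choose_eq, Nat.add_sub_add_right]
  ring

theorem choose_mul_div_choose_eq_descFactorial {M d k i : ℕ} (hk : k ≤ M) (hi : i < d) :
    ((k + d + 1).choose d : ℝ) / M.choose k * ((k + 1) * (M + 2).choose (k + i + 2)) =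
      (M + 2) * (M + 1) / d.factorial *
        ((k + d + 1).descFactorial (d - 1 - i) * (M - k).descFactorial i) := by
  rcases lt_or_ge (M - k) i with h | h
  · rw [Nat.choose_eq_zero_of_lt (n := M + 2) (by omega),
      Nat.descFactorial_eq_zero_iff_lt.2 h]
    simp
  obtain ⟨j, hj⟩ := Nat.exists_eq_add_of_le h
  have e1 := Nat.factorial_mul_descFactorial (show d - 1 - i ≤ k + d + 1 by omega)
  have e2 := Nat.factorial_mul_descFactorial h
  have e3 := Nat.choose_mul_factorial_mul_factorial (show d ≤ k + d + 1 by omega)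
  have e4 := Nat.choose_mul_factorial_mul_factorial hk
  have e5 := Nat.choose_mul_factorial_mul_factorial (show k + i + 2 ≤ M + 2 by omega)
  rw [show k + d + 1 - (d - 1 - i) = k + i + 2 by omega] at e1
  rw [show M - k - i = j by omega] at e2
  rw [show k + d + 1 - d = k + 1 by omega, Nat.factorial_succ k] at e3
  rw [show M + 2 - (k + i + 2) = j by omega, Nat.factorial_succ (M + 1), Nat.factorial_succ M] at e5
  have c0 : (M.choose k : ℝ) ≠ 0 := by exact_mod_cast (Nat.choose_pos hk).ne'
  have f1 := Nat.factorial_ne_zero k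
  have f2 := Nat.factorial_ne_zero j
  have f3 := Nat.factorial_ne_zero (k + i + 2)
  have f4 := Nat.factorial_ne_zero (M - k)
  have f5 := Nat.factorial_ne_zero M
  have f6 := Nat.factorial_ne_zero d
  field_simp
  have goal : (k + d + 1).choose d * (k + 1) * (M + 2).choose (k + i + 2) * d.factorial =
      M.choose k * (M + 2) * (M + 1) * (k + d + 1).descFactorial (d - 1 - i) *
        (M - k).descFactorial i := by
    have hpos : 0 < k.factorial * (k + i + 2).factorial * j.factorial * (M - k).factorial :=
      by positivity
    refine Nat.eq_of_mul_eq_mul_right hpos ?_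
    calc _ = ((k + d + 1).choose d * d.factorial * ((k + 1) * k.factorial)) *
          ((M + 2).choose (k + i + 2) * (k + i + 2).factorial * j.factorial) *
          (M - k).factorial := by ring
      _ = (M.choose k * k.factorial * (M - k).factorial) * (M + 2) * (M + 1) *
          ((k + i + 2).factorial * (k + d + 1).descFactorial (d - 1 - i)) *
          (j.factorial * (M - k).descFactorial i) := by
        rw [e3, e5, e4, e1, e2]; ring
      _ = _ := by ring
  have := congrArg (Nat.cast : ℕ → ℝ) goal
  push_cast at this
  linarith

/-- The polynomial `∑ k, a k * (X - 1).choose k`. -/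
noncomputable def newtonPoly (a : ℕ → ℝ) (d : ℕ) : ℝ[X] :=
  ∑ k ∈ range (d + 1), C (a k / k.factorial) * (descPochhammer ℝ k).comp (X - 1)

theorem newtonPoly_natDegree_le (a : ℕ → ℝ) (d : ℕ) : (newtonPoly a d).natDegree ≤ d := by
  refine natDegree_sum_le_of_forall_le _ _ fun k hk => ?_
  refine (natDegree_C_mul_le _ _).trans (natDegree_comp_le.trans ?_)
  have h1 : (X - 1 : ℝ[X]).natDegree ≤ 1 := by compute_degree
  rw [descPochhammer_natDegree]
  have := mem_range.mp hk
  nlinarith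

theorem newtonPoly_eval_add_one (a : ℕ → ℝ) (d y : ℕ) :
    (newtonPoly a d).eval ((y : ℝ) + 1) = ∑ k ∈ range (d + 1), a k * y.choose k := by
  rw [newtonPoly, eval_finsetSum]
  refine sum_congr rfl fun k _ => ?_
  rw [Nat.cast_choose_eq_descPochhammer_div ℝ]
  simp
  ring

theorem newtonPoly_eval_zero (a : ℕ → ℝ) (d : ℕ) :
    (newtonPoly a d).eval 0 = ∑ k ∈ range (d + 1), (-1) ^ k * a k := by
  rw [newtonPoly, eval_finsetSum]
  refine sum_congr rfl fun k _ => ?_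
  have h := ascPochhammer_eval_neg_eq_descPochhammer ℝ (-1) k
  rw [neg_neg, ascPochhammer_eval_one] at h
  have h1 : ((-1 : ℝ) ^ k) * (-1) ^ k = 1 := by rw [← mul_pow]; simp
  have h2 := Nat.factorial_ne_zero k
  have : (descPochhammer ℝ k).eval (-1) = (-1) ^ k * k.factorial := by
    rw [h, ← mul_assoc, h1, one_mul]
  simp [this]
  field_simp

/-- Coefficients in the Newton basis at `1` of an unnormalised reproducing kernel at `0` of the
polynomials of degree at most `d` on `{0, …, M + 1}`. -/
noncomputable def kernelCoeff (M d k : ℕ) : ℝ :=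
  (-1) ^ k * (d.choose k * ((k + d + 1).choose d / M.choose k))

theorem sum_kernel_mul_eq_zero {M d : ℕ} (hd : d ≤ M) {r : ℝ[X]} (hr : r.degree < d) :
    ∑ y ∈ range (M + 1), ((y : ℝ) + 1) * (newtonPoly (kernelCoeff M d) d).eval ((y : ℝ) + 1) *
      r.eval (y : ℝ) = 0 := by
  refine sum_range_eq_zero_of_choose (fun i hi => ?_) hr
  simp_rw [newtonPoly_eval_add_one, mul_sum, sum_mul]
  rw [sum_comm]
  set P : ℝ[X] := C (((M : ℝ) + 2) * (M + 1) / d.factorial) *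
    ((descPochhammer ℝ (d - 1 - i)).comp (X + C ((d : ℝ) + 1)) *
      (descPochhammer ℝ i).comp (C (M : ℝ) - X)) with hP
  have hdeg : P.natDegree < d := by
    have h1 : (X + C ((d : ℝ) + 1)).natDegree ≤ 1 := by compute_degree
    have h2 : (C (M : ℝ) - X).natDegree ≤ 1 := by compute_degree
    refine lt_of_le_of_lt ((natDegree_C_mul_le _ _).trans (natDegree_mul_le.trans
      (add_le_add natDegree_comp_le natDegree_comp_le))) ?_
    rw [descPochhammer_natDegree, descPochhammer_natDegree]
    have h3 := Nat.mul_le_mul_left (d - 1 - i) h1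
    have h4 := Nat.mul_le_mul_left i h2
    omega
  rw [← sum_range_neg_one_pow_mul_choose_mul_eval hdeg]
  refine sum_congr rfl fun k hk => ?_
  have hk : k ≤ M := (Nat.lt_succ_iff.mp (mem_range.mp hk)).trans hd
  have e : P.eval (k : ℝ) = ((k + d + 1).choose d : ℝ) / M.choose k *
      ((k + 1) * (M + 2).choose (k + i + 2)) := by
    rw [choose_mul_div_choose_eq_descFactorial hk hi, ← descPochhammer_eval_eq_descFactorial ℝ,
      ← descPochhammer_eval_eq_descFactorial ℝ]
    simp [hP, Nat.cast_sub hk, add_assoc]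
  have h := congrArg (Nat.cast : ℕ → ℝ) (sum_range_succ_mul_choose_mul_choose M k i)
  push_cast at h
  rw [e, ← h, mul_sum, mul_sum]
  refine sum_congr rfl fun y _ => ?_
  rw [kernelCoeff]
  ring

theorem sum_kernel {M d : ℕ} (hd : d ≤ M) :
    ∑ y ∈ range (M + 1), (newtonPoly (kernelCoeff M d) d).eval ((y : ℝ) + 1) =
      ((M : ℝ) + 1) / (d + 1) := by
  simp_rw [newtonPoly_eval_add_one]
  rw [sum_comm]
  simp_rw [← mul_sum]
  set P : ℝ[X] := C (1 / (d.factorial : ℝ)) * (descPochhammer ℝ d).comp (X + C (d : ℝ)) with hP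
  have hdeg : P.natDegree < d + 1 := by
    have h1 : (X + C (d : ℝ)).natDegree ≤ 1 := by compute_degree
    refine lt_of_le_of_lt ((natDegree_C_mul_le _ _).trans natDegree_comp_le) ?_
    rw [descPochhammer_natDegree]
    nlinarith
  have hPe : ∀ l : ℕ, P.eval (l : ℝ) = (l + d).choose d := by
    intro l
    rw [Nat.cast_choose_eq_descPochhammer_div ℝ]
    simp [hP]
    ring
  have key := sum_range_neg_one_pow_mul_choose_mul_eval hdeg
  simp_rw [hPe] at key
  rw [sum_range_succ'] at key
  simp only [pow_zero, Nat.choose_zero_right, zero_add, Nat.choose_self, Nat.cast_one,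
    mul_one] at key
  have hd0 : (d : ℝ) + 1 ≠ 0 := by positivity
  rw [show ((M : ℝ) + 1) / (d + 1) = -((M + 1) / (d + 1)) *
    ∑ k ∈ range (d + 1), (-1 : ℝ) ^ (k + 1) * ((d + 1).choose (k + 1)) *
      ((k + 1 + d).choose d) by linear_combination (((M : ℝ) + 1) / (d + 1)) * key, mul_sum]
  refine sum_congr rfl fun k hk => ?_
  have hk : k ≤ M := (Nat.lt_succ_iff.mp (mem_range.mp hk)).trans hd
  have hs : ∑ y ∈ range (M + 1), (y.choose k : ℝ) = (M + 1).choose (k + 1) := by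
    have := sum_range_choose_mul_choose M k 0
    simp only [Nat.choose_zero_right, mul_one, add_zero] at this
    exact_mod_cast this
  have h1 := congrArg (Nat.cast : ℕ → ℝ) (Nat.add_one_mul_choose_eq M k)
  have h2 := congrArg (Nat.cast : ℕ → ℝ) (Nat.add_one_mul_choose_eq d k)
  push_cast at h1 h2
  have c0 : (M.choose k : ℝ) ≠ 0 := by exact_mod_cast (Nat.choose_pos hk).ne'
  have hk0 : (k : ℝ) + 1 ≠ 0 := by positivity
  rw [hs, kernelCoeff, eq_div_of_mul_eq hk0 h1.symm, eq_div_of_mul_eq hk0 h2.symm,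
    show k + d + 1 = k + 1 + d by ring]
  field_simp
  ring

theorem kernel_eval_zero {M d : ℕ} (hd : d ≤ M) :
    (newtonPoly (kernelCoeff M d) d).eval 0 = ((M : ℝ) + 1) / (d + 1) *
      ((M + 1 + (d + 1)).choose (M + 1) / (M + 1).choose (d + 1) - 1) := by
  rw [newtonPoly_eval_zero]
  have h := congrArg (Nat.cast : ℕ → ℝ)
    (sum_range_choose_add_mul_choose (n := M + 1) rfl (Nat.succ_le_succ hd))
  rw [sum_range_succ'] at h
  push_cast at h
  rw [← h]
  simp only [zero_add, Nat.choose_self, Nat.cast_one, one_mul]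
  have c1 : ((M + 1).choose (d + 1) : ℝ) ≠ 0 := by
    exact_mod_cast (Nat.choose_pos (Nat.succ_le_succ hd)).ne'
  rw [add_div _ ((M + 1).choose (d + 1) : ℝ), div_self c1, add_sub_cancel_right, sum_div, mul_sum]
  refine sum_congr rfl fun k hk => ?_
  have hkd : k ≤ d := Nat.lt_succ_iff.mp (mem_range.mp hk)
  have hk : k ≤ M := hkd.trans hd
  have hm := congrArg (Nat.cast : ℕ → ℝ)
    (Nat.choose_mul (n := M + 1) (Nat.succ_le_succ hkd))
  have h1 := congrArg (Nat.cast : ℕ → ℝ) (Nat.add_one_mul_choose_eq M k)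
  have h2 := congrArg (Nat.cast : ℕ → ℝ) (Nat.add_one_mul_choose_eq d k)
  push_cast at h1 h2 hm
  have c0 : (M.choose k : ℝ) ≠ 0 := by exact_mod_cast (Nat.choose_pos hk).ne'
  have hk0 : (k : ℝ) + 1 ≠ 0 := by positivity
  have hs : ((-1 : ℝ) ^ k) * (-1) ^ k = 1 := by rw [← mul_pow]; simp
  rw [eq_div_of_mul_eq hk0 h1.symm, eq_div_of_mul_eq hk0 h2.symm] at hm
  rw [kernelCoeff, ← mul_assoc, hs, one_mul, show k + d + 1 = k + 1 + d by ring]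
  field_simp at hm ⊢
  linear_combination ((k + 1 + d).choose d : ℝ) * hm

theorem sum_kernel_sq {M d : ℕ} (hd : d ≤ M) :
    ∑ y ∈ range (M + 1), (newtonPoly (kernelCoeff M d) d).eval ((y : ℝ) + 1) ^ 2 =
      (newtonPoly (kernelCoeff M d) d).eval 0 * (((M : ℝ) + 1) / (d + 1)) := by
  set G := newtonPoly (kernelCoeff M d) d with hG
  have hr : (taylor 1 G.divX).degree < d := by
    rw [degree_taylor]
    rcases eq_or_ne G 0 with h | h
    · rw [h, divX_zero, degree_zero]
      exact WithBot.bot_lt_coe _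
    · exact (degree_divX_lt h).trans_le (degree_le_of_natDegree_le (newtonPoly_natDegree_le _ _))
  have hx : ∀ x : ℝ, G.eval x = x * G.divX.eval x + G.eval 0 := fun x => by
    conv_lhs => rw [← divX_mul_X_add G]
    simp [coeff_zero_eq_eval_zero, mul_comm]
  have h0 := sum_kernel_mul_eq_zero hd hr
  rw [← hG] at h0
  rw [← sum_kernel hd, mul_sum, ← sub_eq_zero, ← sum_sub_distrib]
  refine (sum_congr rfl fun y _ => ?_).trans h0
  rw [taylor_eval]
  linear_combination G.eval ((y : ℝ) + 1) * hx (y + 1)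

theorem choose_le_exp_mul_choose {n D : ℕ} (h : D ≤ n) :
    (n.choose D : ℝ) ≤ Real.exp (-(D ^ 2 / (2 * n))) * (n + D).choose n := by
  induction D with
  | zero => simp
  | succ D ih =>
    have ih := ih (by omega)
    have hn : (D : ℝ) + 1 ≤ n := by exact_mod_cast h
    have hn0 : (0 : ℝ) < n := lt_of_lt_of_le (by positivity) hn
    have h1 := congrArg (Nat.cast : ℕ → ℝ) (Nat.choose_succ_right_eq n D)
    have h2 := congrArg (Nat.cast : ℕ → ℝ) (Nat.add_one_mul_choose_eq (n + D) D)
    rw [← Nat.choose_symm (by omega), show n + D - D = n by omega,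
      ← Nat.choose_symm (n := n + D + 1) (by omega),
      show n + D + 1 - (D + 1) = n by omega] at h2
    push_cast [Nat.cast_sub (show D ≤ n by omega)] at h1 h2
    have h3 : ((n : ℝ) - D) ≤ Real.exp (-((2 * D + 1) / (2 * n))) * (n + D + 1) := by
      have e1 : 1 - (2 * D + 1) / ((n : ℝ) + D + 1) ≤ Real.exp (-((2 * D + 1) / (2 * n))) := by
        refine (Real.one_sub_le_exp_neg _).trans (Real.exp_le_exp.2 (neg_le_neg ?_))
        gcongr
        linarith
      have e2 := mul_le_mul_of_nonneg_right e1 (show (0 : ℝ) ≤ n + D + 1 by positivity)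
      refine le_trans (le_of_eq ?_) e2
      field_simp
      ring
    have hD : (0 : ℝ) < D + 1 := by positivity
    refine le_of_mul_le_mul_right ?_ hD
    rw [h1]
    calc (n.choose D : ℝ) * (n - D)
        ≤ (Real.exp (-(D ^ 2 / (2 * n))) * (n + D).choose n) *
          (Real.exp (-((2 * D + 1) / (2 * n))) * (n + D + 1)) :=
          mul_le_mul ih h3 (by linarith) (by positivity)
      _ = Real.exp (-(D ^ 2 / (2 * n))) * Real.exp (-((2 * D + 1) / (2 * n))) *
          ((n + D + 1) * (n + D).choose n) := by ring
      _ = _ := by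
        rw [← Real.exp_add, h2, ← add_assoc n D 1]
        push_cast
        rw [show -((D : ℝ) ^ 2 / (2 * n)) + -((2 * D + 1) / (2 * n)) = -(((D : ℝ) + 1) ^ 2 / (2 * n))
          by ring]
        ring

theorem exists_polynomial_abs_le_exp {M d : ℕ} (hd : d ≤ M) :
    ∃ q : ℝ[X], q.natDegree ≤ d ∧
      |1 - q.eval 0| ≤ Real.exp (-((d : ℝ) ^ 2 / (4 * (M + 1)))) ∧
      ∀ y < M + 1, |q.eval ((y : ℝ) + 1)| ≤ Real.exp (-((d : ℝ) ^ 2 / (4 * (M + 1)))) := by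
  set G := newtonPoly (kernelCoeff M d) d with hG
  set ε := Real.exp (-((d : ℝ) ^ 2 / (4 * (M + 1)))) with hε
  have hε0 : 0 < ε := Real.exp_pos _
  have hε1 : ε ≤ 1 := Real.exp_le_one_iff.2 (neg_nonpos.2 (by positivity))
  set S : ℝ := ((M : ℝ) + 1) / (d + 1) with hS
  have hS0 : 0 < S := by positivity
  set B : ℝ := (M + 1).choose (d + 1) / (M + 1 + (d + 1)).choose (M + 1) with hB
  have hc : (0 : ℝ) < (M + 1 + (d + 1)).choose (M + 1) := by
    exact_mod_cast Nat.choose_pos (by omega)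
  have hB0 : 0 < B := div_pos (by exact_mod_cast Nat.choose_pos (by omega)) hc
  have hBε : B ≤ ε ^ 2 := by
    rw [hB, div_le_iff₀ hc]
    refine (choose_le_exp_mul_choose (by omega)).trans ?_
    gcongr
    rw [hε, ← Real.exp_nat_mul]
    refine Real.exp_le_exp.2 ?_
    push_cast
    rw [show 2 * -((d : ℝ) ^ 2 / (4 * (M + 1))) = -((d : ℝ) ^ 2 / (2 * (M + 1))) by
      field_simp; ring]
    gcongr
    linarith
  have hG0 : G.eval 0 = S * (1 / B - 1) := by
    rw [hG, kernel_eval_zero hd, hB, one_div_div]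
  have hsq : ∑ y ∈ range (M + 1), (G.eval ((y : ℝ) + 1)) ^ 2 = G.eval 0 * S := sum_kernel_sq hd
  refine ⟨C (B / S) * G, (natDegree_C_mul_le _ _).trans (newtonPoly_natDegree_le _ _), ?_, ?_⟩
  · rw [eval_mul, eval_C, hG0, show 1 - B / S * (S * (1 / B - 1)) = B by field_simp; ring,
      abs_of_pos hB0]
    nlinarith
  · intro y hy
    refine abs_le_of_sq_le_sq ?_ hε0.le
    rw [eval_mul, eval_C, mul_pow]
    have h1 : (G.eval ((y : ℝ) + 1)) ^ 2 ≤ G.eval 0 * S := by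
      rw [← hsq]
      exact single_le_sum (f := fun y : ℕ => (G.eval ((y : ℝ) + 1)) ^ 2)
        (fun _ _ => sq_nonneg _) (mem_range.2 hy)
    calc (B / S) ^ 2 * (G.eval ((y : ℝ) + 1)) ^ 2 ≤ (B / S) ^ 2 * (G.eval 0 * S) := by gcongr
      _ = B - B ^ 2 := by rw [hG0]; field_simp
      _ ≤ ε ^ 2 := by nlinarith [sq_nonneg B]

theorem one_add_sq_mul_le_eval_T {x : ℝ} (hx : 0 ≤ x) (d : ℕ) :
    1 + d ^ 2 * x ≤ (Chebyshev.T ℝ d).eval (1 + x) := by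
  suffices h : 1 + d ^ 2 * x ≤ (Chebyshev.T ℝ d).eval (1 + x) ∧
      (Chebyshev.T ℝ d).eval (1 + x) + (2 * d + 1) * x ≤
        (Chebyshev.T ℝ (d + 1 : ℕ)).eval (1 + x) from h.1
  induction d with
  | zero => simp
  | succ d ih =>
    have h1 : 1 + ((d + 1 : ℕ) : ℝ) ^ 2 * x ≤ (Chebyshev.T ℝ (d + 1 : ℕ)).eval (1 + x) := by
      push_cast at ih ⊢
      nlinarith [ih.1, ih.2]
    refine ⟨h1, ?_⟩
    have e : (Chebyshev.T ℝ (d + 1 + 1 : ℕ)).eval (1 + x) =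
        2 * (1 + x) * (Chebyshev.T ℝ (d + 1 : ℕ)).eval (1 + x) -
          (Chebyshev.T ℝ d).eval (1 + x) := by
      have := congrArg (eval (1 + x)) (Chebyshev.T_add_two ℝ (d : ℤ))
      push_cast
      rw [add_assoc, one_add_one_eq_two, this]
      simp
    have h2 : x ≤ x * (Chebyshev.T ℝ (d + 1 : ℕ)).eval (1 + x) :=
      le_mul_of_one_le_right hx (le_trans (by simpa using by positivity) h1)
    rw [e]
    have := ih.2
    push_cast at this h2 ⊢
    linarith

theorem exists_polynomial_abs_le_inv {n : ℕ} (hn : 1 ≤ n) (d : ℕ) :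
    ∃ q : ℝ[X], q.natDegree ≤ d ∧
      |1 - q.eval 0| ≤ 1 / (2 + (d : ℝ) ^ 2 / n) ∧
      ∀ y < n, |q.eval ((y : ℝ) + 1)| ≤ 1 / (2 + (d : ℝ) ^ 2 / n) := by
  have hn0 : (0 : ℝ) < n := by exact_mod_cast hn
  set L : ℝ[X] := C (1 + 1 / (n : ℝ)) - C (1 / (n : ℝ)) * X with hL
  have hLd : L.natDegree ≤ 1 := by rw [hL]; compute_degree
  set t := (Chebyshev.T ℝ d).eval (1 + 1 / (n : ℝ)) with ht
  have h1 : 1 + (d : ℝ) ^ 2 / n ≤ t := by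
    have := one_add_sq_mul_le_eval_T (x := 1 / (n : ℝ)) (by positivity) d
    rwa [mul_one_div] at this
  have h0 : 0 ≤ (d : ℝ) ^ 2 / n := by positivity
  have ht1 : 0 < 1 + t := by linarith
  have hle : 1 / (1 + t) ≤ 1 / (2 + (d : ℝ) ^ 2 / n) :=
    one_div_le_one_div_of_le (by linarith) (by linarith)
  refine ⟨C (1 / (1 + t)) * (Chebyshev.T ℝ d).comp L, ?_, ?_, ?_⟩
  · refine (natDegree_C_mul_le _ _).trans (natDegree_comp_le.trans ?_)
    rw [Chebyshev.natDegree_T, Int.natAbs_natCast]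
    nlinarith
  · have e : 1 - (C (1 / (1 + t)) * (Chebyshev.T ℝ d).comp L).eval 0 = 1 / (1 + t) := by
      rw [eval_mul, eval_C, eval_comp, show L.eval 0 = 1 + 1 / (n : ℝ) by simp [hL], ← ht]
      field_simp
      ring
    rw [e, abs_of_pos (by positivity)]
    exact hle
  · intro y hy
    have e : L.eval ((y : ℝ) + 1) = 1 - y / n := by simp [hL]; field_simp; ring
    rw [eval_mul, eval_C, eval_comp, e, abs_mul, abs_of_pos (show 0 < 1 / (1 + t) by positivity)]
    have hy' : (y : ℝ) / n ≤ 1 := (div_le_one hn0).2 (by exact_mod_cast hy.le)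
    have hy0 : 0 ≤ (y : ℝ) / n := by positivity
    refine (mul_le_of_le_one_right (by positivity) ?_).trans hle
    exact Chebyshev.abs_eval_T_real_le_one _ (abs_le.2 ⟨by linarith, by linarith⟩)

theorem one_div_two_add_le_half_exp {t : ℝ} (h0 : 0 ≤ t) (h : t ≤ 6) :
    1 / (2 + t) ≤ 1 / 2 * Real.exp (-(t / 8)) := by
  have h1 := Real.one_sub_le_exp_neg (t / 8)
  have h2 : 1 / (2 + t) ≤ 1 / 2 * (1 - t / 8) := by
    rw [div_le_iff₀ (by linarith)]
    nlinarith
  linarith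

theorem exp_neg_div_four_le_half_exp {t : ℝ} (h : 6 ≤ t) :
    Real.exp (-(t / 4)) ≤ 1 / 2 * Real.exp (-(t / 8)) := by
  rw [show (1 / 2 : ℝ) = Real.exp (-Real.log 2) by
    rw [Real.exp_neg, Real.exp_log two_pos, one_div], ← Real.exp_add]
  refine Real.exp_le_exp.2 ?_
  linarith [Real.log_two_lt_d9]

theorem exists_polynomial_abs_le_half_exp {n d : ℕ} (h : d < n) :
    ∃ q : ℝ[X], q.natDegree ≤ d ∧
      |1 - q.eval 0| ≤ 1 / 2 * Real.exp (-((d : ℝ) ^ 2 / n / 8)) ∧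
      ∀ y < n, |q.eval ((y : ℝ) + 1)| ≤ 1 / 2 * Real.exp (-((d : ℝ) ^ 2 / n / 8)) := by
  rcases le_total ((d : ℝ) ^ 2 / n) 6 with ht | ht
  · have hle := one_div_two_add_le_half_exp (by positivity) ht
    obtain ⟨q, hq, hq0, hqy⟩ := exists_polynomial_abs_le_inv (show 1 ≤ n by omega) d
    exact ⟨q, hq, hq0.trans hle, fun y hy => (hqy y hy).trans hle⟩
  · have hle := exp_neg_div_four_le_half_exp ht
    obtain ⟨M, rfl⟩ : ∃ M, n = M + 1 := ⟨n - 1, by omega⟩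
    obtain ⟨q, hq, hq0, hqy⟩ := exists_polynomial_abs_le_exp (Nat.lt_succ_iff.mp h)
    rw [div_div, mul_comm _ (4 : ℝ), Nat.cast_add_one] at hle
    rw [Nat.cast_add_one]
    exact ⟨q, hq, hq0.trans hle, fun y hy => (hqy y hy).trans hle⟩

theorem totalDegree_aeval_sum_one_sub_X_le {n : ℕ} (q : ℝ[X]) :
    (aeval (∑ i : Fin n, (1 - MvPolynomial.X i : MvPolynomial (Fin n) ℝ)) q).totalDegree ≤
      q.natDegree := by
  have hs : (∑ i : Fin n, (1 - MvPolynomial.X i : MvPolynomial (Fin n) ℝ)).totalDegree ≤ 1 := by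
    refine MvPolynomial.totalDegree_finsetSum_le fun i _ => ?_
    refine (MvPolynomial.totalDegree_sub _ _).trans ?_
    simp
  rw [aeval_eq_sum_range]
  refine MvPolynomial.totalDegree_finsetSum_le fun i hi => ?_
  refine (MvPolynomial.totalDegree_smul_le _ _).trans ((MvPolynomial.totalDegree_pow _ _).trans ?_)
  have := mem_range.mp hi
  nlinarith

theorem eval_aeval_sum_one_sub_X {n : ℕ} (q : ℝ[X]) (x : Fin n → ℝ) :
    MvPolynomial.eval x (aeval (∑ i : Fin n, (1 - MvPolynomial.X i : MvPolynomial (Fin n) ℝ)) q) =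
      q.eval (∑ i, (1 - x i)) := by
  rw [aeval_def, hom_eval₂, eval]
  congr 1
  · ext; simp
  · simp

theorem exists_mvPolynomial_and {n : ℕ} (d : ℕ) :
    ∃ p : MvPolynomial (Fin n) ℝ, p.totalDegree ≤ d ∧
      ∀ x : Fin n → ℝ, (∀ i, x i = 0 ∨ x i = 1) →
        |(∏ i, x i) - MvPolynomial.eval x p| ≤ 1 / 2 * Real.exp (-((d : ℝ) ^ 2 / n / 8)) := by
  rcases le_or_gt n d with h | h
  · refine ⟨∏ i, MvPolynomial.X i, ?_, fun x _ => ?_⟩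
    · refine (MvPolynomial.totalDegree_finsetProd _ _).trans ?_
      simpa using h
    · simp [Real.exp_nonneg]
  obtain ⟨q, hq, hq0, hqy⟩ := exists_polynomial_abs_le_half_exp h
  refine ⟨_, (totalDegree_aeval_sum_one_sub_X_le q).trans hq, fun x hx => ?_⟩
  rw [eval_aeval_sum_one_sub_X]
  have hsum : ∑ i, (1 - x i) = (#{i | x i = 0} : ℕ) := by
    rw [card_filter, Nat.cast_sum]
    refine sum_congr rfl fun i _ => ?_
    rcases hx i with h | h <;> simp [h]
  have hcard : #{i | x i = 0} ≤ n := (card_le_univ _).trans_eq (Fintype.card_fin n)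
  rw [hsum]
  rcases hz : #{i | x i = 0} with _ | y
  · have h1 : ∏ i, x i = 1 := prod_eq_one fun i _ => by
      have : i ∉ ({i | x i = 0} : Finset (Fin n)) := by rw [card_eq_zero.1 hz]; simp
      exact (hx i).resolve_left (by simpa using this)
    rw [h1, Nat.cast_zero]
    exact hq0
  · obtain ⟨i, hi⟩ := card_pos.1 (hz.symm ▸ Nat.succ_pos y : 0 < #{i | x i = 0})
    rw [prod_eq_zero (mem_univ i) (by simpa using hi), zero_sub, abs_neg, Nat.cast_add_one]
    exact hqy y (by omega)


/-- There is a constant `c > 0` such that for all `n ≥ 1` and all `d ≥ 0`, the `n`-bit AND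
function is approximated pointwise on the Boolean cube within `(1/2)·exp(−(c/2)·d²/n)` by a
real polynomial of total degree at most `d`.  Consequently, there is a constant `C > 0` such
that for `0 < ε < 1/2`, `AND_n` is approximated pointwise within `ε` by a polynomial of
degree at most `C·√(n·log(1/ε))`. -/
theorem and_approx :
    (∃ c : ℝ, 0 < c ∧ ∀ n : ℕ, 1 ≤ n → ∀ d : ℕ,
      ∃ p : MvPolynomial (Fin n) ℝ, p.totalDegree ≤ d ∧
        ∀ x : Fin n → ℝ, (∀ i, x i = 0 ∨ x i = 1) →
          |(∏ i, x i) - MvPolynomial.eval x p| ≤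
            (1 / 2) * Real.exp (-(c / 2) * d ^ 2 / n)) ∧
    (∃ C : ℝ, 0 < C ∧ ∀ n : ℕ, 1 ≤ n → ∀ ε : ℝ, 0 < ε → ε < 1 / 2 →
      ∃ d : ℕ, (d : ℝ) ≤ C * Real.sqrt (n * Real.log (1 / ε)) ∧
        ∃ p : MvPolynomial (Fin n) ℝ, p.totalDegree ≤ d ∧
          ∀ x : Fin n → ℝ, (∀ i, x i = 0 ∨ x i = 1) →
            |(∏ i, x i) - MvPolynomial.eval x p| ≤ ε) := by
  refine ⟨⟨1 / 4, by norm_num, fun n _ d => ?_⟩, 5, by norm_num, fun n hn ε hε hε2 => ?_⟩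
  · rw [show -((1 / 4 : ℝ) / 2) * (d : ℝ) ^ 2 / n = -((d : ℝ) ^ 2 / n / 8) by ring]
    exact exists_mvPolynomial_and d
  · have hn1 : (1 : ℝ) ≤ n := by exact_mod_cast hn
    have hn0 : (0 : ℝ) < n := by linarith
    have hL : 1 / 2 ≤ Real.log (1 / ε) := by
      have h2 : Real.log 2 ≤ Real.log (1 / ε) := by
        refine Real.log_le_log two_pos ?_
        rw [le_div_iff₀ hε]
        linarith
      linarith [Real.log_two_gt_d9]
    set s := Real.sqrt (n * Real.log (1 / ε)) with hs
    have hs2 : s ^ 2 = n * Real.log (1 / ε) := Real.sq_sqrt (by positivity)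
    have hs0 : 1 / 2 ≤ s := by
      refine Real.le_sqrt_of_sq_le ?_
      nlinarith
    refine ⟨⌈3 * s⌉₊, ?_, ?_⟩
    · have := Nat.ceil_lt_add_one (show 0 ≤ 3 * s by linarith)
      linarith
    · obtain ⟨p, hp, hpx⟩ := exists_mvPolynomial_and (n := n) ⌈3 * s⌉₊
      refine ⟨p, hp, fun x hx => (hpx x hx).trans ?_⟩
      have hd : 3 * s ≤ (⌈3 * s⌉₊ : ℝ) := Nat.le_ceil _
      have hexp : Real.exp (-((⌈3 * s⌉₊ : ℝ) ^ 2 / n / 8)) ≤ ε := by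
        rw [← Real.le_log_iff_exp_le hε, neg_le, ← Real.log_inv, ← one_div, div_div,
          le_div_iff₀ (by positivity)]
        nlinarith
      linarith
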